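/- Let α > 3 and c > 0. Let H be a real Hilbert space and f : H → ℝ convex and differentiable with ∇f Lipschitz continuous on bounded sets and argmin f nonempty. Let (x_k)_{k ≥ 0} be a sequence in H satisfying, for all k ≥ 1, the implicit recursion (x_{k+1} − 2x_k + x_{k−1}) + (α/k)(x_k − x_{k−1}) + ∇f(x_{k+1}) + (c/k²) x_k = 0 (equivalently, x_{k+1} = prox_f(x_k + (1 − α/k)(x_k − x_{k−1}) − (c/k²) x_k)). Then for every s ∈ [1/2, 1): f(x_k) − min f = o(k^{−2s}), ‖x_k − x_{k−1}‖ = o(k^{−s}), and ‖∇f(x_k)‖ = o(k^{−s}) as k → ∞; that is, k^{2s}(f(x_k) − min f) → 0, k^s ‖x_k − x_{k−1}‖ → 0, and k^s ‖∇f(x_k)‖ → 0. -/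

import Mathlib

open Filter Set

/-- First-order lower bound for a convex function. -/
theorem ConvexOn.add_inner_gradient_le
    {H : Type*} [NormedAddCommGroup H] [InnerProductSpace ℝ H] [CompleteSpace H]
    {f : H → ℝ} {g y : H} (hconv : ConvexOn ℝ Set.univ f) (hgrad : HasGradientAt f g y) (z : H) :
    f y + inner ℝ g (z - y) ≤ f z := by
  have hline : ConvexOn ℝ Set.univ (f ∘ AffineMap.lineMap (k := ℝ) y z) := by
    simpa using hconv.comp_affineMap (AffineMap.lineMap (k := ℝ) y z)
  have hderiv : HasDerivAt (f ∘ AffineMap.lineMap (k := ℝ) y z) (inner ℝ g (z - y)) 0 := by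
    have h := hgrad.hasFDerivAt
    have hl : HasDerivAt (AffineMap.lineMap (k := ℝ) y z) (z - y) 0 := AffineMap.hasDerivAt_lineMap
    rw [← AffineMap.lineMap_apply_zero (k := ℝ) y z] at h
    simpa using h.comp_hasDerivAt (0 : ℝ) hl
  have h := hline.le_slope_of_hasDerivAt (Set.mem_univ 0) (Set.mem_univ 1) one_pos hderiv
  simp [slope_def_field] at h
  linarith

/-- The discrete Lyapunov energy decreases along one step, up to a term of order `1 / k`.
Here `x` is the current iterate, `w` the next increment, `g` the gradient at `x + w`. -/
theorem ipatre_energy_step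
    {H : Type*} [NormedAddCommGroup H] [InnerProductSpace ℝ H]
    {x v w g p : H} {k γ c F F' : ℝ} (hγ : 0 ≤ γ) (hc : 0 ≤ c) (hk : 1 ≤ k)
    (hkγ : γ + 2 ≤ k) (hkc : c * (γ ^ 2 / 4 + 1 / 2) ≤ γ * (k - 1 - γ))
    (hF : 0 ≤ F) (hp : F' ≤ inner ℝ g (x + w - p)) (hw : F' - F ≤ inner ℝ g w)
    (hrec : (k - 3 - γ) • v = k • w + k • g + (c / k) • x) :
    k * (k - γ) * F' + 1 / 2 * ‖(2 : ℝ) • (x + w - p) + (k - 2 - γ) • w‖ ^ 2 +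
        γ * ‖x + w - p‖ ^ 2 + c / 2 * ‖x + w‖ ^ 2 ≤
      (k - 1) * (k - 1 - γ) * F + 1 / 2 * ‖(2 : ℝ) • (x - p) + (k - 3 - γ) • v‖ ^ 2 +
        γ * ‖x - p‖ ^ 2 + c / 2 * ‖x‖ ^ 2 + c * ‖p‖ ^ 2 / k := by
  have hk0 : 0 < k := by linarith
  set d : H := γ • w + k • g + (c / k) • x with hd
  set u : H := (2 : ℝ) • (x + w - p) + (k - 2 - γ) • w with hu
  have hsplit : (2 : ℝ) • (x - p) + (k - 3 - γ) • v = u + d := by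
    rw [hrec, hu, hd]; module
  have hnorm : ‖u + d‖ ^ 2 = ‖u‖ ^ 2 + 2 * inner ℝ d u + ‖d‖ ^ 2 := by
    rw [norm_add_sq_real, real_inner_comm]
  have hdu : inner ℝ d u = 2 * γ * inner ℝ w (x + w - p) + γ * (k - 2 - γ) * ‖w‖ ^ 2 +
      k * (2 * inner ℝ g (x + w - p) + (k - 2 - γ) * inner ℝ g w) +
      c / k * (2 * (‖x‖ ^ 2 - inner ℝ x p) + (k - γ) * inner ℝ x w) := by
    simp only [hd, hu, inner_add_left, inner_add_right, inner_sub_right, inner_smul_left,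
      inner_smul_right, real_inner_self_eq_norm_sq, conj_trivial]
    ring
  have hdist : ‖x - p‖ ^ 2 = ‖x + w - p‖ ^ 2 - 2 * inner ℝ w (x + w - p) + ‖w‖ ^ 2 := by
    rw [show x - p = (x + w - p) - w by abel, norm_sub_sq_real, real_inner_comm]
  have hgradient : k * (k - γ) * F' - (k - 1) * (k - 1 - γ) * F ≤
      k * (2 * inner ℝ g (x + w - p) + (k - 2 - γ) * inner ℝ g w) := by
    have h1 := mul_le_mul_of_nonneg_left hw (by nlinarith : 0 ≤ k * (k - 2 - γ))
    have h2 := mul_le_mul_of_nonneg_left hp (by linarith : 0 ≤ 2 * k)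
    linear_combination h1 + h2 + mul_nonneg (by linarith : 0 ≤ 1 + γ) hF
  have hxw : ‖x + w‖ ^ 2 = ‖x‖ ^ 2 + 2 * inner ℝ x w + ‖w‖ ^ 2 := norm_add_sq_real x w
  have hyoung : γ * inner ℝ x w ≤ ‖x‖ ^ 2 + γ ^ 2 / 4 * ‖w‖ ^ 2 := by
    linear_combination mul_le_mul_of_nonneg_left (real_inner_le_norm x w) hγ +
      sq_nonneg (‖x‖ - γ / 2 * ‖w‖)
  have hcross : inner ℝ x p ≤ ‖x‖ ^ 2 / 2 + ‖p‖ ^ 2 / 2 := by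
    nlinarith [real_inner_le_norm x p, sq_nonneg (‖x‖ - ‖p‖)]
  have htikhonov : c * inner ℝ x w + c / 2 * ‖w‖ ^ 2 -
      c / k * (2 * (‖x‖ ^ 2 - inner ℝ x p) + (k - γ) * inner ℝ x w) ≤
      c * ‖p‖ ^ 2 / k + c * (γ ^ 2 / 4 + 1 / 2) * ‖w‖ ^ 2 := by
    have h1 : c / k * (γ * inner ℝ x w + 2 * inner ℝ x p - 2 * ‖x‖ ^ 2) ≤
        c / k * (‖p‖ ^ 2 + γ ^ 2 / 4 * ‖w‖ ^ 2) :=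
      mul_le_mul_of_nonneg_left (by linarith) (by positivity)
    have h2 : c / k * (γ ^ 2 / 4 * ‖w‖ ^ 2) ≤ c * (γ ^ 2 / 4 * ‖w‖ ^ 2) :=
      mul_le_mul_of_nonneg_right (div_le_self hc hk) (by positivity)
    have h3 : c / k * k = c := by field_simp
    have h4 : c * ‖p‖ ^ 2 / k = c / k * ‖p‖ ^ 2 := by ring
    rw [h4]
    linear_combination h1 + h2 - inner ℝ x w * h3
  have hvel := mul_le_mul_of_nonneg_right hkc (sq_nonneg ‖w‖)
  rw [hsplit, hnorm, hdu, hdist, hxw]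
  linear_combination hgradient + htikhonov + hvel + 1 / 2 * sq_nonneg ‖d‖

/-- Increments of size at most `D / k` accumulate to logarithmic growth. -/
theorem le_add_log_of_step {E : ℕ → ℝ} {D : ℝ} (hD : 0 ≤ D) {K : ℕ} (hK : 1 ≤ K)
    (hstep : ∀ k, K ≤ k → E (k + 1) ≤ E k + D / k) (k : ℕ) (hk : K ≤ k) :
    E k ≤ |E K| + 2 * D * Real.log k := by
  induction k, hk using Nat.le_induction with
  | base =>
    have h := Real.log_natCast_nonneg K
    have := le_abs_self (E K)
    nlinarith [mul_nonneg hD h]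
  | succ k hk ih =>
    have hk1 : (1 : ℝ) ≤ k := by exact_mod_cast hK.trans hk
    have hlog : Real.log k + 1 / (2 * k) ≤ Real.log (k + 1 : ℕ) := by
      have h := Real.one_sub_inv_le_log_of_pos (x := ((k : ℝ) + 1) / k) (by positivity)
      rw [Real.log_div (by positivity) (by positivity)] at h
      have h2 : 1 / (2 * (k : ℝ)) ≤ 1 - (((k : ℝ) + 1) / k)⁻¹ := by
        rw [inv_div, one_sub_div (by positivity), div_le_div_iff₀ (by positivity) (by positivity)]
        linarith
      push_cast
      linarith
    have h := mul_le_mul_of_nonneg_left hlog (by linarith : 0 ≤ 2 * D)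
    have h3 : 2 * D * (1 / (2 * (k : ℝ))) = D / k := by field_simp
    linarith [hstep k hk]

/-- A sequence dominated by `A + B log k` vanishes after multiplication by `k ^ (2 * s - 2)`. -/
theorem tendsto_rpow_mul_of_le_log {a : ℕ → ℝ} {A B s : ℝ} (hs : s < 1)
    (ha : ∀ᶠ k in atTop, 0 ≤ a k) (hle : ∀ᶠ k : ℕ in atTop, a k ≤ A + B * Real.log k) :
    Tendsto (fun k : ℕ => (k : ℝ) ^ (2 * s - 2) * a k) atTop (nhds 0) := by
  have hpow : Tendsto (fun y : ℝ => y ^ (2 * s - 2)) atTop (nhds 0) := by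
    have := tendsto_rpow_neg_atTop (y := 2 - 2 * s) (by linarith)
    simpa using this
  have hlog : Tendsto (fun y : ℝ => y ^ (2 * s - 2) * Real.log y) atTop (nhds 0) := by
    have := (isLittleO_log_rpow_atTop (r := 2 - 2 * s) (by linarith)).tendsto_div_nhds_zero
    refine this.congr' ?_
    filter_upwards [eventually_gt_atTop 0] with y hy
    rw [show 2 * s - 2 = -(2 - 2 * s) by ring, Real.rpow_neg hy.le]
    field_simp
  have hbound : Tendsto (fun k : ℕ => (k : ℝ) ^ (2 * s - 2) * (A + B * Real.log k)) atTop
      (nhds 0) := by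
    have := ((hpow.const_mul A).add (hlog.const_mul B)).comp tendsto_natCast_atTop_atTop
    simp only [mul_zero, add_zero] at this
    refine this.congr fun k => ?_
    simp only [Function.comp_apply]
    ring
  refine squeeze_zero' ?_ ?_ hbound
  · filter_upwards [ha] with k hk
    positivity
  · filter_upwards [hle] with k hk
    gcongr

/-- A nonnegative sequence whose square grows at most logarithmically after multiplication
by `k ^ 2` is `o(k ^ (-s))` for every `s < 1`. -/
theorem tendsto_rpow_mul_of_sq_le_log {a : ℕ → ℝ} {A B s : ℝ} (hs : s < 1)
    (ha : ∀ k, 0 ≤ a k) (hle : ∀ᶠ k : ℕ in atTop, (k : ℝ) ^ 2 * a k ^ 2 ≤ A + B * Real.log k) :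
    Tendsto (fun k : ℕ => (k : ℝ) ^ s * a k) atTop (nhds 0) := by
  have h := (tendsto_rpow_mul_of_le_log hs
    (Eventually.of_forall fun k => by positivity) hle).sqrt
  rw [Real.sqrt_zero] at h
  refine h.congr' ?_
  filter_upwards [eventually_gt_atTop 0] with k hk
  have hk' : (0 : ℝ) < k := by exact_mod_cast hk
  have hsq : (k : ℝ) ^ (2 * s - 2) * ((k : ℝ) ^ 2 * a k ^ 2) = ((k : ℝ) ^ s * a k) ^ 2 := by
    rw [Real.rpow_sub hk', mul_comm 2 s, Real.rpow_mul hk'.le, Real.rpow_two, Real.rpow_two]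
    field_simp
  rw [hsq, Real.sqrt_sq (by have := ha k; positivity)]

/-- Each part of the Lyapunov energy is controlled by the total. -/
theorem ipatre_energy_bounds
    {H : Type*} [NormedAddCommGroup H] [InnerProductSpace ℝ H]
    {x v p : H} {k α c F E : ℝ} (hα : 3 < α) (hc : 0 < c) (hk : 2 * α ≤ k) (hF : 0 ≤ F)
    (hE : (k - 1) * (k - 1 - (α - 3)) * F + 1 / 2 * ‖(2 : ℝ) • (x - p) + (k - α) • v‖ ^ 2 +
      (α - 3) * ‖x - p‖ ^ 2 + c / 2 * ‖x‖ ^ 2 ≤ E) :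
    k ^ 2 * F ≤ 4 * E ∧ k ^ 2 * ‖v‖ ^ 2 ≤ (16 + 32 / (α - 3)) * E ∧ ‖x‖ ^ 2 ≤ 2 / c * E := by
  have hγ : 0 < α - 3 := by linarith
  set u : H := (2 : ℝ) • (x - p) + (k - α) • v with hu
  have hcoef : k ^ 2 / 4 ≤ (k - 1) * (k - 1 - (α - 3)) := by nlinarith
  have hF' := mul_le_mul_of_nonneg_right hcoef hF
  have hF0 : 0 ≤ k ^ 2 / 4 * F := by positivity
  have hu0 : 0 ≤ ‖u‖ ^ 2 := by positivity
  have hd0 : 0 ≤ (α - 3) * ‖x - p‖ ^ 2 := by positivity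
  have hx0 : 0 ≤ c / 2 * ‖x‖ ^ 2 := by positivity
  refine ⟨by linarith, ?_, ?_⟩
  · have hdist : ‖x - p‖ ^ 2 ≤ E / (α - 3) := by
      rw [le_div_iff₀ hγ]; linarith
    have hv : (k - α) ^ 2 * ‖v‖ ^ 2 ≤ 2 * ‖u‖ ^ 2 + 8 * ‖x - p‖ ^ 2 := by
      have h1 : (k - α) • v = u - (2 : ℝ) • (x - p) := by rw [hu]; module
      have h2 := norm_sub_le u ((2 : ℝ) • (x - p))
      rw [← h1, norm_smul, norm_smul, Real.norm_of_nonneg (by linarith : 0 ≤ k - α),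
        Real.norm_two] at h2
      have h3 := pow_le_pow_left₀ (mul_nonneg (by linarith) (norm_nonneg v)) h2 2
      linear_combination h3 + sq_nonneg (‖u‖ - 2 * ‖x - p‖)
    have hk2 : k ^ 2 ≤ 4 * (k - α) ^ 2 := by nlinarith
    have h4 := mul_le_mul_of_nonneg_right hk2 (sq_nonneg ‖v‖)
    have h5 : (16 + 32 / (α - 3)) * E = 16 * E + 32 * (E / (α - 3)) := by ring
    rw [h5]
    linarith
  · have : ‖x‖ ^ 2 ≤ E / (c / 2) := by
      rw [le_div_iff₀ (by positivity)]; linarith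
    calc ‖x‖ ^ 2 ≤ E / (c / 2) := this
      _ = 2 / c * E := by field_simp

/-- Fast convergence rates for the inertial proximal algorithm with Tikhonov
regularization (IPATRE): little-o rates (Theorem 5.1 (i)). -/
theorem ipatre_little_o_rates
    {H : Type*} [NormedAddCommGroup H] [InnerProductSpace ℝ H] [CompleteSpace H]
    (f : H → ℝ) (f' : H → H)
    (hconv : ConvexOn ℝ Set.univ f)
    (hgrad : ∀ y, HasGradientAt f (f' y) y)
    (hlip : ∀ s : Set H, Bornology.IsBounded s → ∃ L : NNReal, LipschitzOnWith L f' s)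
    (xbar : H) (hmin : ∀ y, f xbar ≤ f y)
    (α c : ℝ) (hα : 3 < α) (hc : 0 < c)
    (x : ℕ → H)
    (hrec : ∀ k : ℕ, 1 ≤ k →
      (x (k + 1) - (2 : ℝ) • x k + x (k - 1)) + (α / k) • (x k - x (k - 1)) +
        f' (x (k + 1)) + (c / (k : ℝ) ^ 2) • x k = 0) :
    ∀ s : ℝ, 1 / 2 ≤ s → s < 1 →
      Tendsto (fun k : ℕ => (k : ℝ) ^ (2 * s) * (f (x k) - f xbar)) atTop (nhds 0) ∧
      Tendsto (fun k : ℕ => (k : ℝ) ^ s * ‖x k - x (k - 1)‖) atTop (nhds 0) ∧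
      Tendsto (fun k : ℕ => (k : ℝ) ^ s * ‖f' (x k)‖) atTop (nhds 0) := by
  intro s hs_half hs
  have hF : ∀ k, 0 ≤ f (x k) - f xbar := fun k => sub_nonneg.2 (hmin _)
  set E : ℕ → ℝ := fun k => ((k : ℝ) - 1) * (k - 1 - (α - 3)) * (f (x k) - f xbar) +
    1 / 2 * ‖(2 : ℝ) • (x k - xbar) + ((k : ℝ) - α) • (x k - x (k - 1))‖ ^ 2 +
    (α - 3) * ‖x k - xbar‖ ^ 2 + c / 2 * ‖x k‖ ^ 2 with hEdef
  set T : ℝ := max (2 * α) (c * ((α - 3) ^ 2 / 4 + 1 / 2) / (α - 3) + 1 + (α - 3)) with hT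
  obtain ⟨K, hK⟩ := exists_nat_ge T
  have hlarge : ∀ k : ℕ, K ≤ k → 2 * α ≤ (k : ℝ) ∧
      c * ((α - 3) ^ 2 / 4 + 1 / 2) ≤ (α - 3) * (k - 1 - (α - 3)) := by
    intro k hk
    have hTk : T ≤ k := hK.trans (by exact_mod_cast hk)
    refine ⟨(le_max_left _ _).trans hTk, ?_⟩
    have h := (le_max_right _ _).trans hTk
    rw [mul_comm (α - 3), ← div_le_iff₀ (by linarith)]
    linarith
  have hK1 : 1 ≤ K := by
    have : (1 : ℝ) ≤ K := by linarith [(hlarge K le_rfl).1]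
    exact_mod_cast this
  have hvel : ∀ k : ℕ, K ≤ k → f' (x (k + 1)) =
      (1 - α / k) • (x k - x (k - 1)) - (x (k + 1) - x k) - (c / (k : ℝ) ^ 2) • x k := by
    intro k hk
    rw [← sub_eq_zero, ← hrec k (hK1.trans hk)]
    module
  have hstep : ∀ k : ℕ, K ≤ k → E (k + 1) ≤ E k + c * ‖xbar‖ ^ 2 / k := by
    intro k hk
    obtain ⟨hkα, hkc⟩ := hlarge k hk
    have hk0 : (0 : ℝ) < k := by linarith
    have hw : f (x (k + 1)) - f xbar - (f (x k) - f xbar) ≤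
        inner ℝ (f' (x (k + 1))) (x (k + 1) - x k) := by
      have h := hconv.add_inner_gradient_le (hgrad (x (k + 1))) (x k)
      rw [← neg_sub, inner_neg_right] at h
      linarith
    have hp : f (x (k + 1)) - f xbar ≤
        inner ℝ (f' (x (k + 1))) (x k + (x (k + 1) - x k) - xbar) := by
      have h := hconv.add_inner_gradient_le (hgrad (x (k + 1))) xbar
      rw [← neg_sub, inner_neg_right] at h
      rw [add_sub_cancel]
      linarith
    have hr : ((k : ℝ) - 3 - (α - 3)) • (x k - x (k - 1)) =
        (k : ℝ) • (x (k + 1) - x k) + (k : ℝ) • f' (x (k + 1)) + (c / k) • x k := by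
      rw [hvel k hk]
      match_scalars <;> field_simp <;> ring
    have h := ipatre_energy_step (by linarith) hc.le (by linarith) (by linarith) hkc
      (hF k) hp hw hr
    simp only [hEdef, Nat.add_sub_cancel, add_sub_cancel] at h ⊢
    push_cast
    convert h using 2 <;> ring_nf
  have hlog := le_add_log_of_step (D := c * ‖xbar‖ ^ 2) (by positivity) hK1 hstep
  set A := |E K|
  set B := 2 * (c * ‖xbar‖ ^ 2)
  have hbounds : ∀ k : ℕ, K ≤ k → _ := fun k hk =>
    ipatre_energy_bounds hα hc (hlarge k hk).1 (hF k) (hlog k hk)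
  have hev : ∀ᶠ k : ℕ in atTop, K ≤ k := eventually_ge_atTop K
  have hv : Tendsto (fun k : ℕ => (k : ℝ) ^ s * ‖x k - x (k - 1)‖) atTop (nhds 0) := by
    refine tendsto_rpow_mul_of_sq_le_log (A := (16 + 32 / (α - 3)) * A)
      (B := (16 + 32 / (α - 3)) * B) hs (fun k => norm_nonneg _) ?_
    filter_upwards [hev] with k hk
    linarith [(hbounds k hk).2.1]
  have hx : Tendsto (fun k : ℕ => (k : ℝ) ^ s * (‖x k‖ / k)) atTop (nhds 0) := by
    refine tendsto_rpow_mul_of_sq_le_log (A := 2 / c * A) (B := 2 / c * B) hs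
      (fun k => by positivity) ?_
    filter_upwards [hev] with k hk
    have hk0 : (k : ℝ) ≠ 0 := by have := (hlarge k hk).1; linarith
    rw [div_pow, mul_div_cancel₀ _ (by positivity)]
    linarith [(hbounds k hk).2.2]
  refine ⟨?_, hv, ?_⟩
  · refine (tendsto_rpow_mul_of_le_log (a := fun k : ℕ => (k : ℝ) ^ 2 * (f (x k) - f xbar))
      (A := 4 * A) (B := 4 * B) hs
      (Eventually.of_forall fun k => mul_nonneg (by positivity) (hF k)) ?_).congr' ?_
    · filter_upwards [hev] with k hk
      linarith [(hbounds k hk).1]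
    · filter_upwards [hev] with k hk
      have hk0 : (0 : ℝ) < k := by have := (hlarge k hk).1; linarith
      rw [Real.rpow_sub hk0, Real.rpow_two]
      field_simp
  · rw [← tendsto_add_atTop_iff_nat 1]
    have hv1 := (tendsto_add_atTop_iff_nat 1).2 hv
    have hsum := hv1.add ((hv.const_mul 2).add (hx.const_mul (2 * c)))
    simp only [mul_zero, add_zero] at hsum
    refine squeeze_zero' (Eventually.of_forall fun k => by positivity) ?_ hsum
    filter_upwards [hev] with k hk
    obtain ⟨hkα, -⟩ := hlarge k hk
    have hk0 : (0 : ℝ) < k := by linarith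
    have hpow : ((k + 1 : ℕ) : ℝ) ^ s ≤ 2 * (k : ℝ) ^ s := by
      calc ((k + 1 : ℕ) : ℝ) ^ s ≤ (2 * (k : ℝ)) ^ s :=
            Real.rpow_le_rpow (by positivity) (by push_cast; linarith) (by linarith)
        _ = 2 ^ s * (k : ℝ) ^ s := Real.mul_rpow (by norm_num) hk0.le
        _ ≤ 2 ^ (1 : ℝ) * (k : ℝ) ^ s := by gcongr; norm_num
        _ = 2 * (k : ℝ) ^ s := by rw [Real.rpow_one]
    have hg : ‖f' (x (k + 1))‖ ≤
        ‖x (k + 1) - x k‖ + (‖x k - x (k - 1)‖ + c * (‖x k‖ / k)) := by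
      have h1 : ‖(1 - α / k) • (x k - x (k - 1))‖ ≤ ‖x k - x (k - 1)‖ := by
        rw [norm_smul]
        refine mul_le_of_le_one_left (norm_nonneg _) ?_
        have h0 : α / k ≤ 1 := by rw [div_le_one hk0]; linarith
        have h2 : 0 ≤ α / k := by positivity
        rw [Real.norm_of_nonneg] <;> linarith
      have h2 : ‖(c / (k : ℝ) ^ 2) • x k‖ ≤ c * (‖x k‖ / k) := by
        rw [norm_smul, Real.norm_of_nonneg (by positivity), mul_div_assoc', div_mul_eq_mul_div]
        gcongr
        exact le_self_pow₀ (by linarith) two_ne_zero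
      rw [hvel k hk]
      have h3 := norm_sub_le ((1 - α / k) • (x k - x (k - 1)) - (x (k + 1) - x k))
        ((c / (k : ℝ) ^ 2) • x k)
      have h4 := norm_sub_le ((1 - α / k) • (x k - x (k - 1))) (x (k + 1) - x k)
      linarith
    have h5 := mul_le_mul_of_nonneg_left hg (by positivity : 0 ≤ ((k + 1 : ℕ) : ℝ) ^ s)
    have h6 := mul_le_mul_of_nonneg_right hpow
      (by positivity : 0 ≤ ‖x k - x (k - 1)‖ + c * (‖x k‖ / k))
    simp only [Nat.add_sub_cancel]
    linarith
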